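/- arXiv:1807.04439 — 5 statements merged into one kernel-verified Lean document; each statement's English description precedes it below -/
import Mathlib

section
/- Let S be a set (state space), A a nonempty finite set (action space), f : S × A → S a deterministic transition function, G ⊆ S a subset (the absorbing set), π̄ : A → ℝ a probability vector (π̄(a) ≥ 0 for all a and ∑_{a∈A} π̄(a) = 1), and τ > 0. For k = 1, …, n let r_k : S × A → ℝ be reward functions that all agree outside G (i.e. for every s ∉ G and a ∈ A, r_k(s,a) = r_1(s,a) for all k), and let Q_k : S × A → ℝ satisfy the soft Bellman fixed-point equations for reward r_k: Q_k(s,a) = r_k(s,a) whenever s ∈ G, and Q_k(s,a) = r_k(s,a) + τ·log(∑_{a'∈A} π̄(a')·exp(Q_k(f(s,a),a')/τ)) whenever s ∉ G. Let w_1, …, w_n ≥ 0 with ∑_k w_k = 1. Define the composed function Q(s,a) = τ·log(∑_k w_k·exp(Q_k(s,a)/τ)) and the composed reward r by r(s,a) = τ·log(∑_k w_k·exp(r_k(s,a)/τ)) for s ∈ G and r(s,a) = r_1(s,a) for s ∉ G. Then Q satisfies the soft Bellman fixed-point equations for reward r: Q(s,a) = r(s,a) whenever s ∈ G, and Q(s,a)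 = r(s,a) + τ·log(∑_{a'∈A} π̄(a')·exp(Q(f(s,a),a')/τ)) whenever s ∉ G. -/
open Real Finset

theorem weighted_exp_pos {ι : Type*} [Fintype ι] (p : ι → ℝ) (h0 : ∀ i, 0 ≤ p i)
    (h1 : ∑ i, p i = 1) (g : ι → ℝ) : 0 < ∑ i, p i * Real.exp (g i) := by
  have hne : ∃ i, p i ≠ 0 := by
    by_contra! h
    simp [h] at h1
  obtain ⟨i, hi⟩ := hne
  exact Finset.sum_pos' (fun j _ => mul_nonneg (h0 j) (Real.exp_pos _).le)
    ⟨i, Finset.mem_univ i, mul_pos (lt_of_le_of_ne (h0 i) (Ne.symm hi)) (Real.exp_pos _)⟩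

/-- Theorem 2 (Optimal Composition), core: if each `Q k` satisfies the soft Bellman
fixed-point equations for reward `r k`, where the rewards agree outside the absorbing
set `G`, then the weighted soft-max composition `Qc` satisfies the soft Bellman
fixed-point equations for the composed reward `rc`. -/
theorem optimal_composition
    {S A : Type*} [Fintype A] [Nonempty A]
    (f : S × A → S) (G : Set S)
    (pibar : A → ℝ) (hpibar_nonneg : ∀ a, 0 ≤ pibar a) (hpibar_sum : ∑ a, pibar a = 1)
    (τ : ℝ) (hτ : 0 < τ)
    {n : ℕ} (hn : 0 < n)
    (r : Fin n → S × A → ℝ)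
    (hr_agree : ∀ k : Fin n, ∀ s : S, s ∉ G → ∀ a : A, r k (s, a) = r ⟨0, hn⟩ (s, a))
    (Q : Fin n → S × A → ℝ)
    (hQ_G : ∀ k : Fin n, ∀ s : S, s ∈ G → ∀ a : A, Q k (s, a) = r k (s, a))
    (hQ_notG : ∀ k : Fin n, ∀ s : S, s ∉ G → ∀ a : A,
      Q k (s, a) = r k (s, a)
        + τ * Real.log (∑ a' : A, pibar a' * Real.exp (Q k (f (s, a), a') / τ)))
    (w : Fin n → ℝ) (hw_nonneg : ∀ k, 0 ≤ w k) (hw_sum : ∑ k, w k = 1)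
    (Qc : S × A → ℝ)
    (hQc : ∀ p : S × A, Qc p = τ * Real.log (∑ k : Fin n, w k * Real.exp (Q k p / τ)))
    (rc : S × A → ℝ)
    (hrc_G : ∀ s : S, s ∈ G → ∀ a : A,
      rc (s, a) = τ * Real.log (∑ k : Fin n, w k * Real.exp (r k (s, a) / τ)))
    (hrc_notG : ∀ s : S, s ∉ G → ∀ a : A, rc (s, a) = r ⟨0, hn⟩ (s, a)) :
    (∀ s : S, s ∈ G → ∀ a : A, Qc (s, a) = rc (s, a)) ∧
    (∀ s : S, s ∉ G → ∀ a : A,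
      Qc (s, a) = rc (s, a)
        + τ * Real.log (∑ a' : A, pibar a' * Real.exp (Qc (f (s, a), a') / τ))) := by
  have hτ' : τ ≠ 0 := hτ.ne'
  have hexp : ∀ p, Real.exp (Qc p / τ) = ∑ k : Fin n, w k * Real.exp (Q k p / τ) := by
    intro p
    rw [hQc, mul_div_cancel_left₀ _ hτ', Real.exp_log (weighted_exp_pos w hw_nonneg hw_sum _)]
  refine ⟨fun s hs a => ?_, fun s hs a => ?_⟩
  · rw [hQc, hrc_G s hs a]
    simp only [hQ_G _ s hs a]
  · have hk : ∀ k, Real.exp (Q k (s, a) / τ) = Real.exp (rc (s, a) / τ) *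
        ∑ a' : A, pibar a' * Real.exp (Q k (f (s, a), a') / τ) := by
      intro k
      rw [hQ_notG k s hs a, hr_agree k s hs a, ← hrc_notG s hs a, add_div,
        mul_div_cancel_left₀ _ hτ', Real.exp_add,
        Real.exp_log (weighted_exp_pos pibar hpibar_nonneg hpibar_sum _)]
    have hsum : ∑ k, w k * Real.exp (Q k (s, a) / τ) = Real.exp (rc (s, a) / τ) *
        ∑ a' : A, pibar a' * Real.exp (Qc (f (s, a), a') / τ) := by
      simp only [hk, hexp, Finset.mul_sum]
      rw [Finset.sum_comm]
      refine Finset.sum_congr rfl fun a' _ => Finset.sum_congr rfl fun k _ => ?_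
      ring
    rw [hQc, hsum, Real.log_mul (Real.exp_pos _).ne'
      (weighted_exp_pos pibar hpibar_nonneg hpibar_sum _).ne', Real.log_exp, mul_add,
      mul_div_cancel₀ _ hτ']
end

section
/- Let A be a nonempty finite set, π̄ : A → ℝ a probability vector (π̄(a) ≥ 0 for all a and ∑_{a∈A} π̄(a) = 1), Q : A → ℝ, and τ > 0. Define the Boltzmann policy π* : A → ℝ by π*(a) = π̄(a)·exp(Q(a)/τ) / (∑_{a'∈A} π̄(a')·exp(Q(a')/τ)). Then π* is a probability vector absolutely continuous with respect to π̄ (π*(a) ≥ 0, ∑_a π*(a) = 1, and π*(a) = 0 whenever π̄(a) = 0), and it attains the soft-max value: ∑_{a∈A} π*(a)·Q(a) − τ·∑_{a : π*(a) > 0} π*(a)·log(π*(a)/π̄(a)) = τ·log(∑_{a∈A} π̄(a)·exp(Q(a)/τ)). -/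
open Real Finset

/-- Attainment part of Lemma 1: the Boltzmann policy is a probability vector absolutely
continuous with respect to the reference policy `π̄`, and it attains the soft-max value
`τ·log ∑ π̄(a)·exp(Q(a)/τ)` in the KL-regularised objective. -/
theorem boltzmann_attains_softmax
    {A : Type*} [Fintype A] [Nonempty A]
    (pibar : A → ℝ) (hpibar_nonneg : ∀ a, 0 ≤ pibar a) (hpibar_sum : ∑ a, pibar a = 1)
    (Q : A → ℝ) (τ : ℝ) (hτ : 0 < τ)
    (pstar : A → ℝ)
    (hpstar : ∀ a, pstar a =
      pibar a * Real.exp (Q a / τ) / ∑ a', pibar a' * Real.exp (Q a' / τ)) :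
    (∀ a, 0 ≤ pstar a) ∧ (∑ a, pstar a = 1) ∧ (∀ a, pibar a = 0 → pstar a = 0) ∧
    (∑ a, pstar a * Q a
        - τ * ∑ a ∈ Finset.univ.filter (fun a => 0 < pstar a),
            pstar a * Real.log (pstar a / pibar a)
      = τ * Real.log (∑ a, pibar a * Real.exp (Q a / τ))) := by
  set Z := ∑ a', pibar a' * Real.exp (Q a' / τ) with hZ
  have hterm : ∀ a, 0 ≤ pibar a * Real.exp (Q a / τ) := fun a =>
    mul_nonneg (hpibar_nonneg a) (Real.exp_pos _).le
  have hZpos : 0 < Z := by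
    have hex : ∃ a ∈ (Finset.univ : Finset A), 0 < pibar a := by
      by_contra hcon
      push Not at hcon
      have := Finset.sum_nonpos hcon
      linarith
    obtain ⟨a, ha, hpos⟩ := hex
    exact Finset.sum_pos' (fun b _ => hterm b) ⟨a, ha, mul_pos hpos (Real.exp_pos _)⟩
  have hnn : ∀ a, 0 ≤ pstar a := fun a => by
    rw [hpstar a]; exact div_nonneg (hterm a) hZpos.le
  have hsum : ∑ a, pstar a = 1 := by
    simp only [hpstar]
    rw [← Finset.sum_div, ← hZ, div_self hZpos.ne']
  have hac : ∀ a, pibar a = 0 → pstar a = 0 := fun a h => by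
    rw [hpstar a, h]; simp
  refine ⟨hnn, hsum, hac, ?_⟩
  have hkl : ∑ a ∈ Finset.univ.filter (fun a => 0 < pstar a),
      pstar a * Real.log (pstar a / pibar a)
      = ∑ a, pstar a * (Q a / τ - Real.log Z) := by
    rw [Finset.sum_filter]
    refine Finset.sum_congr rfl fun a _ => ?_
    split_ifs with h
    · have hb : pibar a ≠ 0 := fun h0 => h.ne' (hac a h0)
      have hq : pstar a / pibar a = Real.exp (Q a / τ) / Z := by
        rw [hpstar a]
        field_simp
      rw [hq, Real.log_div (Real.exp_pos _).ne' hZpos.ne', Real.log_exp]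
    · have h0 : pstar a = 0 := le_antisymm (not_lt.mp h) (hnn a)
      rw [h0, zero_mul]
  rw [hkl, Finset.mul_sum, ← Finset.sum_sub_distrib]
  have : ∀ a, pstar a * Q a - τ * (pstar a * (Q a / τ - Real.log Z))
      = pstar a * (τ * Real.log Z) := fun a => by
    field_simp
    ring
  simp only [this]
  rw [← Finset.sum_mul, hsum, one_mul]
end

section
/- Let A be a nonempty finite set, π̄ : A → ℝ a probability vector (π̄(a) ≥ 0 for all a and ∑_{a∈A} π̄(a) = 1), Q : A → ℝ, and τ > 0. Suppose π : A → ℝ is a probability vector with π(a) = 0 whenever π̄(a) = 0, and suppose π attains the soft-max value: ∑_{a∈A} π(a)·Q(a) − τ·∑_{a : π(a) > 0} π(a)·log(π(a)/π̄(a)) = τ·log(∑_{a∈A} π̄(a)·exp(Q(a)/τ)). Then π equals the Boltzmann policy: π(a) = π̄(a)·exp(Q(a)/τ) / (∑_{a'∈A} π̄(a')·exp(Q(a')/τ)) for every a ∈ A. -/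
open Real Finset

/-- Uniqueness part of Lemma 1: any probability vector `p` absolutely continuous with
respect to the reference policy `π̄` that attains the soft-max value in the
KL-regularised objective must equal the Boltzmann policy. -/
theorem boltzmann_unique_maximiser
    {A : Type*} [Fintype A] [Nonempty A]
    (pibar : A → ℝ) (hpibar_nonneg : ∀ a, 0 ≤ pibar a) (hpibar_sum : ∑ a, pibar a = 1)
    (Q : A → ℝ) (τ : ℝ) (hτ : 0 < τ)
    (p : A → ℝ) (hp_nonneg : ∀ a, 0 ≤ p a) (hp_sum : ∑ a, p a = 1)
    (hac : ∀ a, pibar a = 0 → p a = 0)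
    (hattain : ∑ a, p a * Q a
        - τ * ∑ a ∈ Finset.univ.filter (fun a => 0 < p a),
            p a * Real.log (p a / pibar a)
      = τ * Real.log (∑ a, pibar a * Real.exp (Q a / τ))) :
    ∀ a, p a = pibar a * Real.exp (Q a / τ) / ∑ a', pibar a' * Real.exp (Q a' / τ) := by
  have hfil : ∑ a ∈ Finset.univ.filter (fun a => 0 < p a), p a * Real.log (p a / pibar a)
      = ∑ a, p a * Real.log (p a / pibar a) := by
    apply Finset.sum_filter_of_ne
    intro a _ h
    exact lt_of_le_of_ne (hp_nonneg a) (fun h0 => h (by rw [← h0, zero_mul]))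
  rw [hfil] at hattain
  set Z := ∑ a, pibar a * Real.exp (Q a / τ) with hZ
  have hterm : ∀ a, 0 ≤ pibar a * Real.exp (Q a / τ) :=
    fun a => mul_nonneg (hpibar_nonneg a) (Real.exp_pos _).le
  have hZpos : 0 < Z := by
    refine lt_of_le_of_ne (Finset.sum_nonneg fun a _ => hterm a) (fun h => ?_)
    have h0 := (Finset.sum_eq_zero_iff_of_nonneg (fun a _ => hterm a)).1 h.symm
    have h1 : ∀ a, pibar a = 0 := fun a =>
      (mul_eq_zero.1 (h0 a (Finset.mem_univ a))).resolve_right (Real.exp_pos _).ne'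
    simp [h1] at hpibar_sum
  have hqsum : ∑ a, pibar a * Real.exp (Q a / τ) / Z = 1 := by
    rw [← Finset.sum_div, ← hZ, div_self hZpos.ne']
  have key : ∀ a, p a * (Q a / τ - Real.log (p a / pibar a) - Real.log Z)
        ≤ pibar a * Real.exp (Q a / τ) / Z - p a ∧
      (p a * (Q a / τ - Real.log (p a / pibar a) - Real.log Z)
        = pibar a * Real.exp (Q a / τ) / Z - p a →
        p a = pibar a * Real.exp (Q a / τ) / Z) := by
    intro a
    rcases (hp_nonneg a).eq_or_lt with h0 | hpos
    · rw [← h0]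
      have := div_nonneg (hterm a) hZpos.le
      constructor
      · linarith
      · intro h; linarith
    · have hb : 0 < pibar a :=
        lt_of_le_of_ne (hpibar_nonneg a) (fun h => hpos.ne' (hac a h.symm))
      have hq : 0 < pibar a * Real.exp (Q a / τ) / Z := by positivity
      have hlog : Q a / τ - Real.log (p a / pibar a) - Real.log Z
          = Real.log (pibar a * Real.exp (Q a / τ) / Z / p a) := by
        rw [Real.log_div hq.ne' hpos.ne', Real.log_div (by positivity) hZpos.ne',
          Real.log_mul hb.ne' (Real.exp_pos _).ne', Real.log_exp,
          Real.log_div hpos.ne' hb.ne']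
        ring
      rw [hlog]
      set q := pibar a * Real.exp (Q a / τ) / Z
      have hmul : p a * (q / p a - 1) = q - p a := by field_simp
      rw [← hmul]
      constructor
      · exact mul_le_mul_of_nonneg_left (Real.log_le_sub_one_of_pos (by positivity)) hpos.le
      · intro h
        by_contra hne
        have hne1 : q / p a ≠ 1 := fun h1 => hne ((div_eq_one_iff_eq hpos.ne').1 h1).symm
        exact (Real.log_lt_sub_one_of_pos (by positivity) hne1).ne
          (mul_left_cancel₀ hpos.ne' h)
  have hsum : ∑ a, p a * (Q a / τ - Real.log (p a / pibar a) - Real.log Z)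
      = ∑ a, (pibar a * Real.exp (Q a / τ) / Z - p a) := by
    rw [Finset.sum_sub_distrib, hqsum, hp_sum, sub_self]
    simp only [mul_sub, Finset.sum_sub_distrib]
    rw [← Finset.sum_mul, hp_sum]
    have : ∑ a, p a * (Q a / τ) = (∑ a, p a * Q a) / τ := by
      rw [Finset.sum_div]
      exact Finset.sum_congr rfl fun a _ => by ring
    rw [this, eq_add_of_sub_eq hattain]
    field_simp
    ring
  intro a
  exact (key a).2 ((Finset.sum_eq_sum_iff_of_le fun a _ => (key a).1).1 hsum a
    (Finset.mem_univ a))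
end

section
/- Let n ≥ 1 and let w_1, …, w_n be real weights with w_k > 0 for all k and ∑_k w_k = 1. Let (τ_m)_{m∈ℕ} be a sequence of positive reals with τ_m → 0, and for each k ∈ {1,…,n} let (q_k(m))_{m∈ℕ} be a nondecreasing sequence of reals converging to b_k ∈ ℝ. Then the composed values τ_m·log(∑_{k=1}^n w_k·exp(q_k(m)/τ_m)) converge to max_k b_k as m → ∞. -/
open Real Finset Filter

/-- Analytic core of Corollary 1: with positive weights summing to 1, temperatures
`τ m ↓ 0`, and values `q k m` nondecreasing in `m` with limits `b k`, the composed
values `τ m · log (∑ k, w k · exp (q k m / τ m))` converge to `max_k b k`. -/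
theorem composed_values_tendsto_max
    {n : ℕ} (hn : 0 < n)
    (w : Fin n → ℝ) (hw_pos : ∀ k, 0 < w k) (hw_sum : ∑ k, w k = 1)
    (τ : ℕ → ℝ) (hτ_pos : ∀ m, 0 < τ m) (hτ_lim : Tendsto τ atTop (nhds 0))
    (q : Fin n → ℕ → ℝ) (hq_mono : ∀ k, Monotone (q k))
    (b : Fin n → ℝ) (hq_lim : ∀ k, Tendsto (q k) atTop (nhds (b k))) :
    Tendsto (fun m => τ m * Real.log (∑ k : Fin n, w k * Real.exp (q k m / τ m)))
      atTop
      (nhds (Finset.univ.sup'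
        (Finset.univ_nonempty_iff.mpr (Fin.pos_iff_nonempty.mp hn)) b)) := by
  have hne : (Finset.univ : Finset (Fin n)).Nonempty :=
    Finset.univ_nonempty_iff.mpr (Fin.pos_iff_nonempty.mp hn)
  obtain ⟨j, -, hj⟩ := Finset.exists_mem_eq_sup' hne b
  have hle : ∀ k, b k ≤ b j := fun k => hj ▸ Finset.le_sup' b (Finset.mem_univ k)
  rw [hj]
  have hlow : Tendsto (fun m => τ m * Real.log (w j) + q j m) atTop (nhds (b j)) := by
    simpa using (hτ_lim.mul_const (Real.log (w j))).add (hq_lim j)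
  have hterm : ∀ m k, 0 < w k * Real.exp (q k m / τ m) :=
    fun m k => mul_pos (hw_pos k) (Real.exp_pos _)
  have hsingle : ∀ m, w j * Real.exp (q j m / τ m)
      ≤ ∑ k : Fin n, w k * Real.exp (q k m / τ m) := fun m =>
    Finset.single_le_sum (f := fun k => w k * Real.exp (q k m / τ m))
      (fun k _ => (hterm m k).le) (Finset.mem_univ j)
  refine tendsto_of_tendsto_of_tendsto_of_le_of_le hlow tendsto_const_nhds ?_ ?_
  · intro m
    have hτ := hτ_pos m
    have h1 := Real.log_le_log (hterm m j) (hsingle m)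
    rw [Real.log_mul (hw_pos j).ne' (Real.exp_pos _).ne', Real.log_exp] at h1
    have h2 := mul_le_mul_of_nonneg_left h1 hτ.le
    have h3 : τ m * (Real.log (w j) + q j m / τ m) = τ m * Real.log (w j) + q j m := by
      field_simp
    rw [h3] at h2
    exact h2
  · intro m
    have hτ := hτ_pos m
    have hsum : ∑ k : Fin n, w k * Real.exp (q k m / τ m) ≤ Real.exp (b j / τ m) := by
      calc ∑ k : Fin n, w k * Real.exp (q k m / τ m)
          ≤ ∑ k : Fin n, w k * Real.exp (b j / τ m) := by
            refine Finset.sum_le_sum fun k _ => ?_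
            refine mul_le_mul_of_nonneg_left (Real.exp_le_exp.mpr ?_) (hw_pos k).le
            exact div_le_div_of_nonneg_right
              (((hq_mono k).ge_of_tendsto (hq_lim k) m).trans (hle k)) hτ.le
        _ = Real.exp (b j / τ m) := by rw [← Finset.sum_mul, hw_sum, one_mul]
    have h1 := Real.log_le_log ((hterm m j).trans_le (hsingle m)) hsum
    rw [Real.log_exp] at h1
    have h2 := mul_le_mul_of_nonneg_left h1 hτ.le
    rw [mul_div_cancel₀ _ hτ.ne'] at h2
    exact h2
end

section
/- For every τ > 0 there exists ε₀ ∈ (0,1) such that for all ε ∈ (0, ε₀): −(1 + τ·ε·log(2ε))/(1 − ε) − τ·log(2(1 − ε)) > −1 − τ·log 2. -/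
open Real

/-- The paper's counterexample: for every temperature `τ > 0` there is `ε₀ ∈ (0,1)` such
that for all `ε ∈ (0, ε₀)` the stochastic policy value
`−(1 + τ·ε·log(2ε))/(1−ε) − τ·log(2(1−ε))` exceeds the deterministic policy value
`−1 − τ·log 2`, so the optimal entropy-regularised policy is non-deterministic. -/
theorem stochastic_beats_deterministic
    (τ : ℝ) (hτ : 0 < τ) :
    ∃ ε₀ : ℝ, 0 < ε₀ ∧ ε₀ < 1 ∧
      ∀ ε : ℝ, 0 < ε → ε < ε₀ →
        -((1 + τ * ε * Real.log (2 * ε)) / (1 - ε)) - τ * Real.log (2 * (1 - ε))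
          > -1 - τ * Real.log 2 := by
  have he : Real.exp (-(1 / τ)) < 1 := by
    rw [Real.exp_lt_one_iff]
    have : 0 < 1 / τ := by positivity
    linarith
  refine ⟨Real.exp (-(1 / τ)) / 2, by positivity, by linarith, ?_⟩
  intro ε h0 h1
  have h2 : 0 < 1 - ε := by linarith
  have h3 : Real.log (2 * ε) < -(1 / τ) := by
    rw [Real.log_lt_iff_lt_exp (by positivity)]
    linarith
  have h4 : τ * Real.log (2 * ε) < -1 := by
    have h := mul_lt_mul_of_pos_left h3 hτ
    have h' : τ * -(1 / τ) = -1 := by field_simp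
    linarith
  have h5 : (1 + τ * ε * Real.log (2 * ε)) / (1 - ε) < 1 := by
    rw [div_lt_one h2]
    nlinarith [mul_lt_mul_of_pos_left h4 h0]
  have h6 : Real.log (1 - ε) < 0 := Real.log_neg h2 (by linarith)
  rw [Real.log_mul (by norm_num) h2.ne']
  nlinarith [mul_neg_of_pos_of_neg hτ h6]
end
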